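/- For k ≥ 3, the number of permutations in S_k avoiding all of the patterns 321, 2143, and 3124 equals (k³ - 3k² + 5k)/3. -/

import Mathlib

/-- The word `w` (of length `k`) contains the pattern `v` (of length `m`) if some
subsequence of `w` has the same relative order as `v`. -/
def ContainsPat {k m : ℕ} (w : Fin k → ℕ) (v : Fin m → ℕ) : Prop :=
  ∃ f : Fin m → Fin k, StrictMono f ∧ ∀ a b : Fin m, v a < v b ↔ w (f a) < w (f b)

open Equiv

/-- `w` has no subsequence ordered like `321`, `2143` or `3124`. -/
def IsAvoider {k : ℕ} (w : Fin k → Fin k) : Prop :=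
  (∀ a b c, a < b → b < c → w c < w b → w b < w a → False) ∧
  (∀ a b c d, a < b → b < c → c < d → w b < w a → w a < w d → w d < w c → False) ∧
  (∀ a b c d, a < b → b < c → c < d → w b < w c → w c < w a → w a < w d → False)

theorem containsPat_321_iff {k : ℕ} (w : Fin k → ℕ) :
    ContainsPat w ![3, 2, 1] ↔ ∃ a b c, a < b ∧ b < c ∧ w c < w b ∧ w b < w a := by
  constructor
  · rintro ⟨f, hf, h⟩
    exact ⟨f 0, f 1, f 2, hf (by decide), hf (by decide),
      (h 2 1).1 (by decide), (h 1 0).1 (by decide)⟩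
  · rintro ⟨a, b, c, h1, h2, h3, h4⟩
    refine ⟨![a, b, c], Fin.strictMono_iff_lt_succ.2 ?_, ?_⟩
    · simp [Fin.forall_fin_succ, h1, h2]
    · simp [Fin.forall_fin_succ]; omega

theorem containsPat_2143_iff {k : ℕ} (w : Fin k → ℕ) :
    ContainsPat w ![2, 1, 4, 3] ↔
      ∃ a b c d, a < b ∧ b < c ∧ c < d ∧ w b < w a ∧ w a < w d ∧ w d < w c := by
  constructor
  · rintro ⟨f, hf, h⟩
    exact ⟨f 0, f 1, f 2, f 3, hf (by decide), hf (by decide), hf (by decide),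
      (h 1 0).1 (by decide), (h 0 3).1 (by decide), (h 3 2).1 (by decide)⟩
  · rintro ⟨a, b, c, d, h1, h2, h3, h4, h5, h6⟩
    refine ⟨![a, b, c, d], Fin.strictMono_iff_lt_succ.2 ?_, ?_⟩
    · simp [Fin.forall_fin_succ, h1, h2, h3]
    · simp [Fin.forall_fin_succ]; omega

theorem containsPat_3124_iff {k : ℕ} (w : Fin k → ℕ) :
    ContainsPat w ![3, 1, 2, 4] ↔
      ∃ a b c d, a < b ∧ b < c ∧ c < d ∧ w b < w c ∧ w c < w a ∧ w a < w d := by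
  constructor
  · rintro ⟨f, hf, h⟩
    exact ⟨f 0, f 1, f 2, f 3, hf (by decide), hf (by decide), hf (by decide),
      (h 1 2).1 (by decide), (h 2 0).1 (by decide), (h 0 3).1 (by decide)⟩
  · rintro ⟨a, b, c, d, h1, h2, h3, h4, h5, h6⟩
    refine ⟨![a, b, c, d], Fin.strictMono_iff_lt_succ.2 ?_, ?_⟩
    · simp [Fin.forall_fin_succ, h1, h2, h3]
    · simp [Fin.forall_fin_succ]; omega

theorem isAvoider_iff {k : ℕ} (σ : Perm (Fin k)) :
    IsAvoider σ ↔
      ¬ ContainsPat (fun i => ((σ i : ℕ) + 1)) ![3, 2, 1] ∧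
      ¬ ContainsPat (fun i => ((σ i : ℕ) + 1)) ![2, 1, 4, 3] ∧
      ¬ ContainsPat (fun i => ((σ i : ℕ) + 1)) ![3, 1, 2, 4] := by
  rw [containsPat_321_iff, containsPat_2143_iff, containsPat_3124_iff]
  simp only [IsAvoider, add_lt_add_iff_right, Fin.val_fin_lt]
  push Not
  simp only [← not_lt]

/-- A permutation of `Fin k` is determined by its set of inversions. -/
theorem perm_eq_of_lt_iff {k : ℕ} {σ τ : Perm (Fin k)}
    (h : ∀ i j, i < j → (σ i < σ j ↔ τ i < τ j)) : σ = τ := by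
  have key : ∀ i j, σ i < σ j → τ i < τ j := by
    intro i j hij
    rcases lt_trichotomy i j with hlt | rfl | hlt
    · exact (h i j hlt).1 hij
    · exact absurd hij (lt_irrefl _)
    · refine lt_of_le_of_ne (not_lt.1 fun h' => ?_) fun h' => hlt.ne (τ.injective h').symm
      exact absurd ((h j i hlt).2 h') hij.asymm
  have hmono : StrictMono (σ.symm.trans τ) := fun x y hxy =>
    key _ _ (by simpa using hxy)
  have := Subsingleton.elim
    (hmono.orderIsoOfSurjective _ (σ.symm.trans τ).surjective) (OrderIso.refl _)
  ext i
  have hi := DFunLike.congr_fun this (σ i)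
  simp only [StrictMono.coe_orderIsoOfSurjective, OrderIso.refl_apply, trans_apply,
    symm_apply_apply] at hi
  rw [hi]

/-- The parameters of the avoiders in `S_{n+1}` that do not fix the first letter. -/
def params (n : ℕ) : Finset (ℕ × ℕ) :=
  insert (n, n) (Finset.Ico 1 n ×ˢ Finset.Icc 1 n)

theorem mem_params {n x y : ℕ} (hn : 1 ≤ n) :
    (x, y) ∈ params n ↔ 1 ≤ x ∧ x ≤ n ∧ 1 ≤ y ∧ y ≤ n ∧ (x = n → y = n) := by
  simp only [params, Finset.mem_insert, Finset.mem_product, Finset.mem_Ico, Finset.mem_Icc,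
    Prod.mk.injEq]
  omega

theorem card_params (n : ℕ) : (params n).card = (n - 1) * n + 1 := by
  rw [params, Finset.card_insert_of_notMem (by simp)]
  simp

/-- The avoider (zero-based) whose letter `0` stands at position `x`. If `x < y`, the letter `1`
stands at position `y`; otherwise the first letter is `1`, and `y` is the number of letters
preceding `0` that are smaller than all the nonzero letters following it. -/
def word (n x y i : ℕ) : ℕ :=
  if x < y then
    if i < x then n + 2 - y + i else if i = x then 0 else if i < y then n + 1 - y + i
    else i - y + 1
  else
    if i < y then i + 1 else if i < x then i + 1 + (n - x) else if i = x then 0 else i - x + y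

section word

variable {n x y : ℕ}

theorem word_of_lt (h : x < y) (i : ℕ) :
    (i < x ∧ word n x y i = n + 2 - y + i) ∨ (i = x ∧ word n x y i = 0) ∨
    (x < i ∧ i < y ∧ word n x y i = n + 1 - y + i) ∨ (y ≤ i ∧ word n x y i = i - y + 1) := by
  unfold word
  split_ifs <;> omega

theorem word_of_le (h : y ≤ x) (i : ℕ) :
    (i < y ∧ word n x y i = i + 1) ∨ (y ≤ i ∧ i < x ∧ word n x y i = i + 1 + (n - x)) ∨
    (i = x ∧ word n x y i = 0) ∨ (x < i ∧ word n x y i = i - x + y) := by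
  unfold word
  split_ifs <;> omega

theorem word_le (hp : 1 ≤ y ∧ x ≤ n ∧ y ≤ n) {i : ℕ} (hi : i ≤ n) : word n x y i ≤ n := by
  unfold word
  split_ifs <;> omega

theorem word_inj (hp : 1 ≤ y ∧ x ≤ n ∧ y ≤ n) {i j : ℕ} (hi : i ≤ n) (hj : j ≤ n)
    (h : word n x y i = word n x y j) : i = j := by
  rcases lt_or_ge x y with hxy | hxy
  · have := word_of_lt (n := n) hxy i
    have := word_of_lt (n := n) hxy j
    omega
  · have := word_of_le (n := n) hxy i
    have := word_of_le (n := n) hxy j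
    omega

/-- The permutation of `Fin (n + 1)` with one-line notation `word n x y`. -/
noncomputable def wordPerm (hp : 1 ≤ y ∧ x ≤ n ∧ y ≤ n) : Perm (Fin (n + 1)) :=
  Equiv.ofBijective
    (fun i => ⟨word n x y i, Nat.lt_succ_of_le (word_le hp (Nat.le_of_lt_succ i.2))⟩)
    (Finite.injective_iff_bijective.1 fun i j h =>
      Fin.ext (word_inj hp (Nat.le_of_lt_succ i.2) (Nat.le_of_lt_succ j.2) (Fin.ext_iff.1 h)))

theorem val_wordPerm (hp : 1 ≤ y ∧ x ≤ n ∧ y ≤ n) (i : Fin (n + 1)) :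
    (wordPerm hp i : ℕ) = word n x y i := rfl

theorem isAvoider_wordPerm (hp : 1 ≤ y ∧ x ≤ n ∧ y ≤ n) : IsAvoider (wordPerm hp) := by
  simp only [IsAvoider, Fin.lt_def, val_wordPerm]
  rcases lt_or_ge x y with hxy | hxy
  · refine ⟨fun a b c hab hbc h1 h2 => ?_, fun a b c d hab hbc hcd h1 h2 h3 => ?_,
      fun a b c d hab hbc hcd h1 h2 h3 => ?_⟩
    · rcases word_of_lt (n := n) hxy a with h | h | h | h <;>
      rcases word_of_lt (n := n) hxy b with h' | h' | h' | h' <;> try omega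
      all_goals have := word_of_lt (n := n) hxy c; omega
    all_goals
      have := d.2
      rcases word_of_lt (n := n) hxy a with h | h | h | h <;>
      rcases word_of_lt (n := n) hxy b with h' | h' | h' | h' <;> try omega
      all_goals
        rcases word_of_lt (n := n) hxy d with h'' | h'' | h'' | h'' <;> try omega
      all_goals have := word_of_lt (n := n) hxy c; omega
  · refine ⟨fun a b c hab hbc h1 h2 => ?_, fun a b c d hab hbc hcd h1 h2 h3 => ?_,
      fun a b c d hab hbc hcd h1 h2 h3 => ?_⟩
    · have := c.2
      rcases word_of_le (n := n) hxy a with h | h | h | h <;>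
      rcases word_of_le (n := n) hxy b with h' | h' | h' | h' <;> try omega
      all_goals have := word_of_le (n := n) hxy c; omega
    all_goals
      have := d.2
      rcases word_of_le (n := n) hxy a with h | h | h | h <;>
      rcases word_of_le (n := n) hxy b with h' | h' | h' | h' <;> try omega
      all_goals
        rcases word_of_le (n := n) hxy d with h'' | h'' | h'' | h'' <;> try omega
      all_goals have := word_of_le (n := n) hxy c; omega

theorem wordPerm_zero_ne (hp : 1 ≤ y ∧ x ≤ n ∧ y ≤ n) (hx : 1 ≤ x) : wordPerm hp 0 ≠ 0 := by
  intro h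
  have h : word n x y 0 = 0 := Fin.ext_iff.1 h
  unfold word at h
  split_ifs at h <;> omega

theorem wordPerm_inj {x' y' : ℕ} (hp : 1 ≤ y ∧ x ≤ n ∧ y ≤ n) (hp' : 1 ≤ y' ∧ x' ≤ n ∧ y' ≤ n)
    (hx : 1 ≤ x) (hx' : 1 ≤ x') (hxn : x = n → y = n) (hxn' : x' = n → y' = n)
    (h : wordPerm hp = wordPerm hp') : x = x' ∧ y = y' := by
  have key : ∀ i ≤ n, word n x y i = word n x' y' i := fun i hi => by
    have := congrArg (fun σ : Perm (Fin (n + 1)) => (σ ⟨i, Nat.lt_succ_of_le hi⟩ : ℕ)) h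
    simpa only [val_wordPerm] using this
  have hxx : x = x' := by
    refine word_inj hp hp.2.1 hp'.2.1 ?_
    rw [key x' hp'.2.1]
    unfold word
    split_ifs <;> omega
  subst hxx
  refine ⟨rfl, ?_⟩
  have h0 := key 0 (Nat.zero_le n)
  by_cases hn : x = n
  · omega
  have h1 := key (x + 1) (by omega)
  unfold word at h0 h1
  split_ifs at h0 h1 <;> omega

end word

theorem IsAvoider.exists_eq_wordPerm {n : ℕ} {σ : Perm (Fin (n + 1))} (hσ : IsAvoider σ)
    (h0 : σ 0 ≠ 0) :
    ∃ x y, ∃ hp : 1 ≤ y ∧ x ≤ n ∧ y ≤ n, 1 ≤ x ∧ (x = n → y = n) ∧ σ = wordPerm hp := by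
  obtain ⟨h321, h2143, h3124⟩ := hσ
  obtain ⟨p, hp⟩ := σ.surjective 0
  have hne : ∀ {i j}, i ≠ j → σ i ≠ σ j := fun h h' => h (σ.injective h')
  have hp0 : 0 < p := Fin.pos_iff_ne_zero.2 fun h => h0 (h ▸ hp)
  have hpos : ∀ i, i ≠ p → σ p < σ i := fun i hi => by
    have := hne hi
    rw [hp] at this ⊢
    exact Fin.pos_iff_ne_zero.2 this
  have hbefore : ∀ i j, i < j → j < p → σ i < σ j := fun i j hij hj =>
    (hne hij.ne).lt_of_le <| not_lt.1 fun h => h321 i j p hij hj (hpos j hj.ne) h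
  have hafter : ∀ i j, p < i → i < j → σ 0 < σ j → σ i < σ j := fun i j hi hij hj =>
    (hne hij.ne).lt_of_le <| not_lt.1 fun h => h2143 0 p i j hp0 hi hij (hpos 0 hp0.ne) hj h
  have hpn : (p : ℕ) ≤ n := Nat.le_of_lt_succ p.2
  by_cases h1 : (σ 0 : ℕ) = 1
  · have hafter' : ∀ i j, p < i → i < j → σ i < σ j := fun i j hi hij => hafter i j hi hij <| by
      have h2 := hpos j (hi.trans hij).ne'
      have h3 := hne (show (0 : Fin (n + 1)) ≠ j from (hp0.trans (hi.trans hij)).ne)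
      rw [hp] at h2
      omega
    by_cases hpn' : (p : ℕ) = n
    · refine ⟨p, n, ⟨by omega, hpn, le_rfl⟩, hp0, fun _ => rfl,
        perm_eq_of_lt_iff fun i j hij => ?_⟩
      rw [Fin.lt_def (a := wordPerm _ i), val_wordPerm, val_wordPerm]
      have hi := word_of_le (n := n) (hpn'.ge) i
      have hj := word_of_le (n := n) (hpn'.ge) j
      rcases eq_or_ne j p with rfl | hjp
      · have := hpos i hij.ne
        omega
      · have := hbefore i j hij (by omega)
        omega
    · obtain ⟨b, hb⟩ : ∃ b : Fin (n + 1), (b : ℕ) = p + 1 := ⟨⟨p + 1, by omega⟩, rfl⟩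
      have hpb : p < b := by omega
      have hex : ∃ i, i = p ∨ σ b < σ i := ⟨p, Or.inl rfl⟩
      obtain ⟨y, hy, hmin⟩ := WellFounded.has_min wellFounded_lt {i | i = p ∨ σ b < σ i} hex
      have hyp : y ≤ p := not_lt.1 (hmin p (Or.inl rfl))
      have hlow : ∀ i < y, σ i < σ b := fun i hi => by
        have h : ¬ (i = p ∨ σ b < σ i) := fun h => hmin i h hi
        exact (hne (show i ≠ b by omega)).lt_of_le (not_lt.1 fun h' => h (Or.inr h'))
      have hhigh : ∀ i, y ≤ i → i < p → σ b < σ i := fun i hi hip => by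
        have hy' : σ b < σ y := hy.resolve_left (by omega)
        rcases eq_or_lt_of_le hi with rfl | hi
        · exact hy'
        · exact hy'.trans (hbefore y i hi hip)
      have hb_le : ∀ j, p < j → σ b ≤ σ j := fun j hj => by
        rcases eq_or_ne b j with rfl | h
        · exact le_rfl
        · exact (hafter' b j hpb (by omega)).le
      have hy0 : 0 < y := Fin.pos_iff_ne_zero.2 fun h => by
        have h2 := hhigh 0 h.le hp0
        have h3 := hpos b hpb.ne'
        omega
      refine ⟨p, y, ⟨hy0, hpn, by omega⟩, hp0, by omega, perm_eq_of_lt_iff fun i j hij => ?_⟩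
      rw [Fin.lt_def (a := wordPerm _ i), val_wordPerm, val_wordPerm]
      have hi := word_of_le (n := n) (Fin.le_def.1 hyp) i
      have hj := word_of_le (n := n) (Fin.le_def.1 hyp) j
      rcases lt_trichotomy j p with hjp | rfl | hjp
      · have := hbefore i j hij hjp
        omega
      · have := hpos i hij.ne
        omega
      · have hbj := hb_le j hjp
        rcases lt_trichotomy i p with hip | rfl | hip
        · rcases lt_or_ge i y with hiy | hiy
          · have := hlow i hiy
            omega
          · have hbi := hhigh i hiy hip
            have : σ j < σ i := by
              rcases eq_or_ne b j with rfl | h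
              · exact hbi
              · exact (hne hij.ne').lt_of_le <| not_lt.1 fun h' =>
                  h3124 i p b j hip hpb (by omega) (hpos b hpb.ne') hbi h'
            omega
        · have := hpos j hjp.ne'
          omega
        · have := hafter' i j hip hij
          omega
  · obtain ⟨q, hq⟩ := σ.surjective ⟨1, by omega⟩
    have hq1 : (σ q : ℕ) = 1 := by rw [hq]
    have hp1 : (σ p : ℕ) = 0 := by rw [hp]; rfl
    have hσ0 : 1 < (σ 0 : ℕ) := by
      have := hpos 0 hp0.ne
      omega
    have hq_lt : ∀ i, i ≠ p → i ≠ q → σ q < σ i := fun i hi hi' => by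
      have h2 := hpos i hi
      have h3 := hne hi'
      omega
    have hq0 : 0 < q := Fin.pos_iff_ne_zero.2 fun h => by subst h; omega
    have hpq : p < q := by
      rcases lt_trichotomy p q with h | rfl | h
      · exact h
      · omega
      · have := hbefore 0 q hq0 h
        omega
    have hlow : ∀ j, q ≤ j → σ j < σ 0 := fun j hj => by
      rcases eq_or_lt_of_le hj with rfl | hj
      · omega
      · exact (hne (hq0.trans hj).ne').lt_of_le <| not_lt.1 fun h =>
          h3124 0 p q j hp0 hpq hj (hpos q hpq.ne') (by omega) h
    have hhigh : ∀ i, i < q → i ≠ p → σ 0 ≤ σ i := fun i hi hip => by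
      rcases eq_or_ne i 0 with rfl | h
      · exact le_rfl
      · exact not_lt.1 fun h' =>
          h321 0 i q (Fin.pos_iff_ne_zero.2 h) hi (hq_lt i hip hi.ne) h'
    refine ⟨p, q, ⟨hq0, hpn, Nat.le_of_lt_succ q.2⟩, hp0, by omega,
      perm_eq_of_lt_iff fun i j hij => ?_⟩
    rw [Fin.lt_def (a := wordPerm _ i), val_wordPerm, val_wordPerm]
    have hi := word_of_lt (n := n) (Fin.lt_def.1 hpq) i
    have hj := word_of_lt (n := n) (Fin.lt_def.1 hpq) j
    rcases eq_or_ne j p with rfl | hjp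
    · have := hpos i hij.ne
      omega
    rcases eq_or_ne i p with rfl | hip
    · have := hpos j hjp
      omega
    rcases lt_or_ge j q with hjq | hjq
    · have : σ i < σ j := (hne hij.ne).lt_of_le <| not_lt.1 fun h =>
        h321 i j q hij hjq (hq_lt j hjp hjq.ne) h
      omega
    have hj0 := hlow j hjq
    rcases lt_or_ge i q with hiq | hiq
    · have := hhigh i hiq hip
      omega
    · have : σ i < σ j := (hne hij.ne).lt_of_le <| not_lt.1 fun h =>
        h321 0 i j (hq0.trans_le hiq) hij h (hlow i hiq)
      omega

/-- Prefixing a permutation by a new smallest letter. -/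
def consZero {n : ℕ} (τ : Perm (Fin n)) : Perm (Fin (n + 1)) := Perm.decomposeFin.symm (0, τ)

theorem consZero_zero {n : ℕ} (τ : Perm (Fin n)) : consZero τ 0 = 0 := by simp [consZero]

theorem consZero_succ {n : ℕ} (τ : Perm (Fin n)) (i : Fin n) :
    consZero τ i.succ = (τ i).succ := by simp [consZero]

theorem consZero_injective {n : ℕ} : Function.Injective (consZero (n := n)) := fun τ τ' h => by
  simpa [consZero] using h

theorem exists_eq_consZero {n : ℕ} {σ : Perm (Fin (n + 1))} (h : σ 0 = 0) :
    ∃ τ, σ = consZero τ := by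
  obtain ⟨⟨m, τ⟩, rfl⟩ := Perm.decomposeFin.symm.surjective σ
  rw [Perm.decomposeFin_symm_apply_zero] at h
  exact ⟨τ, by rw [h, consZero]⟩

theorem isAvoider_consZero {n : ℕ} (τ : Perm (Fin n)) :
    IsAvoider (consZero τ) ↔ IsAvoider τ := by
  simp [IsAvoider, Fin.forall_fin_succ, consZero_zero, consZero_succ]

theorem card_isAvoider_succ {n : ℕ} (hn : 1 ≤ n) :
    Nat.card {σ : Perm (Fin (n + 1)) // IsAvoider σ} =
      Nat.card {σ : Perm (Fin n) // IsAvoider σ} + ((n - 1) * n + 1) := by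
  have hmem (t : params n) := (mem_params (x := t.1.1) (y := t.1.2) hn).1 t.2
  have hval (t : params n) : 1 ≤ t.1.2 ∧ t.1.1 ≤ n ∧ t.1.2 ≤ n := by grind
  let f : {σ : Perm (Fin n) // IsAvoider σ} ⊕ params n →
      {σ : Perm (Fin (n + 1)) // IsAvoider σ} :=
    Sum.elim (fun τ => ⟨consZero τ.1, (isAvoider_consZero τ.1).2 τ.2⟩)
      (fun t => ⟨wordPerm (hval t), isAvoider_wordPerm _⟩)
  have hf : Function.Bijective f := by
    constructor
    · refine Function.Injective.sumElim ?_ ?_ ?_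
      · exact fun τ τ' h => Subtype.ext (consZero_injective (Subtype.ext_iff.1 h))
      · intro t t' h
        have := wordPerm_inj (hval t) (hval t') (hmem t).1 (hmem t').1 (hmem t).2.2.2.2
          (hmem t').2.2.2.2 (Subtype.ext_iff.1 h)
        exact Subtype.ext (Prod.ext this.1 this.2)
      · intro τ t h
        refine wordPerm_zero_ne (hval t) (hmem t).1 ?_
        have h : consZero τ.1 = wordPerm (hval t) := Subtype.ext_iff.1 h
        rw [← h, consZero_zero]
    · rintro ⟨σ, hσ⟩
      by_cases h0 : σ 0 = 0
      · obtain ⟨τ, rfl⟩ := exists_eq_consZero h0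
        exact ⟨Sum.inl ⟨τ, (isAvoider_consZero τ).1 hσ⟩, rfl⟩
      · obtain ⟨x, y, hp, hx, hxn, rfl⟩ := hσ.exists_eq_wordPerm h0
        exact ⟨Sum.inr ⟨(x, y), (mem_params hn).2 ⟨hx, hp.2.1, hp.1, hp.2.2, hxn⟩⟩, rfl⟩
  rw [← Nat.card_eq_of_bijective f hf, Nat.card_sum, Nat.card_eq_fintype_card (α := params n),
    Fintype.card_coe, card_params]

theorem card_isAvoider {k : ℕ} (hk : 1 ≤ k) :
    (Nat.card {σ : Perm (Fin k) // IsAvoider σ} : ℚ) =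
      ((k : ℚ) ^ 3 - 3 * (k : ℚ) ^ 2 + 5 * (k : ℚ)) / 3 := by
  induction k, hk using Nat.le_induction with
  | base =>
    have : Unique {σ : Perm (Fin 1) // IsAvoider σ} :=
      ⟨⟨⟨1, by simp [IsAvoider]⟩⟩, fun _ => Subsingleton.elim _ _⟩
    rw [Nat.card_unique]
    norm_num
  | succ n hn ih =>
    rw [card_isAvoider_succ hn]
    push_cast [Nat.cast_sub hn]
    rw [ih]
    ring

/-- For `k ≥ 3`, the number of permutations in `S_k` avoiding all of the patterns
`321`, `2143`, and `3124` equals `(k³ - 3k² + 5k)/3`. -/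
theorem avoiders_count (k : ℕ) (hk : 3 ≤ k) :
    (Nat.card {σ : Equiv.Perm (Fin k) //
        ¬ ContainsPat (fun i => ((σ i : ℕ) + 1)) ![3, 2, 1] ∧
        ¬ ContainsPat (fun i => ((σ i : ℕ) + 1)) ![2, 1, 4, 3] ∧
        ¬ ContainsPat (fun i => ((σ i : ℕ) + 1)) ![3, 1, 2, 4]} : ℚ) =
      ((k : ℚ) ^ 3 - 3 * (k : ℚ) ^ 2 + 5 * (k : ℚ)) / 3 := by
  simp only [← isAvoider_iff]
  exact card_isAvoider (by omega)
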